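/- (Theorem 3.2) On the fractal triple F̄ there exists no G-eigenform: there exist no irreducible Dirichlet form E on V⁰, weight vector r ∈ (0,∞)^{20}, and ρ > 0 such that Λ_r(E) = ρ·E. -/

import Mathlib

/-- A Dirichlet form on a finite set `V`, invariant with respect to an additive
constant: a functional of the form `E u = ∑_{{p,q} ⊆ V, p ≠ q} c_{p,q} (u p - u q)²`
with nonnegative coefficients (encoded via a symmetric nonnegative coefficient
matrix, summing over ordered pairs; the diagonal terms vanish). -/
def IsDirichletForm {V : Type*} [Fintype V] (E : (V → ℝ) → ℝ) : Prop :=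
  ∃ c : V → V → ℝ, (∀ p q, 0 ≤ c p q) ∧ (∀ p q, c p q = c q p) ∧
    ∀ u : V → ℝ, E u = ∑ p, ∑ q, c p q * (u p - u q) ^ 2

/-- An irreducible Dirichlet form: moreover `E u = 0` iff `u` is constant. -/
def IsIrreducibleDirichletForm {V : Type*} [Fintype V] (E : (V → ℝ) → ℝ) : Prop :=
  IsDirichletForm E ∧ ∀ u : V → ℝ, E u = 0 ↔ ∀ p q, u p = u q

/-- The fractal triple `F̄` of Section 3, with `N = k = 20`. Points and maps are
indexed by `ZMod 20` (indices read modulo 20). `V⁰` is encoded by the injective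
family `P : ZMod 20 → V1` of points of the finite set `V¹ = V1`, and the
one-to-one maps `ψ i : V⁰ → V¹` are encoded as injective maps `ZMod 20 → V1`
covering `V¹`, with `ψ j (P j) = P j` and `P j ∉ ψ i (V⁰)` for `i ≠ j`.
The cells `V_i = ψ i (V⁰)` satisfy `V_i ∩ V_{i'} = ∅` if `i' ∉ {i-1, i, i+1}`,
and `V_i ∩ V_{i+1} = {Q̄_i}` where `Q̄_i = ψ i (P (i+1)) = ψ (i+1) (P i)` for `i`
odd and `Q̄_i = ψ i (P (i+9)) = ψ (i+1) (P (i-8))` for `i` even. -/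
structure ExampleFractal (V1 : Type*) [Fintype V1] where
  P : ZMod 20 → V1
  P_inj : Function.Injective P
  ψ : ZMod 20 → ZMod 20 → V1
  ψ_inj : ∀ i, Function.Injective (ψ i)
  cover : ∀ y : V1, ∃ i j, ψ i j = y
  fixed : ∀ j, ψ j j = P j
  sep : ∀ i j, i ≠ j → P j ∉ Set.range (ψ i)
  disj : ∀ i i' : ZMod 20, i' ≠ i - 1 → i' ≠ i → i' ≠ i + 1 →
    Set.range (ψ i) ∩ Set.range (ψ i') = ∅
  inter_odd : ∀ i : ZMod 20, i.val % 2 = 1 →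
    ψ i (i + 1) = ψ (i + 1) i ∧
    Set.range (ψ i) ∩ Set.range (ψ (i + 1)) = {ψ i (i + 1)}
  inter_even : ∀ i : ZMod 20, i.val % 2 = 0 →
    ψ i (i + 9) = ψ (i + 1) (i - 8) ∧
    Set.range (ψ i) ∩ Set.range (ψ (i + 1)) = {ψ i (i + 9)}

variable {V1 : Type*} [Fintype V1]

/-- `S_{1,r}(E)(v) = ∑ i, r i * E (v ∘ ψ i)`. -/
noncomputable def S1r (F : ExampleFractal V1) (r : ZMod 20 → ℝ)
    (E : (ZMod 20 → ℝ) → ℝ) (v : V1 → ℝ) : ℝ :=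
  ∑ i, r i * E (fun j => v (F.ψ i j))

/-- The renormalization operator:
`Λ_r(E)(u) = inf { S_{1,r}(E)(v) : v : V1 → ℝ, v = u on V⁰ }`. -/
noncomputable def Lam (F : ExampleFractal V1) (r : ZMod 20 → ℝ)
    (E : (ZMod 20 → ℝ) → ℝ) (u : ZMod 20 → ℝ) : ℝ :=
  sInf {x : ℝ | ∃ v : V1 → ℝ, (∀ j, v (F.P j) = u j) ∧ S1r F r E v = x}

open Finset

/-- The symmetric bilinear form attached to a matrix of coefficients. -/
noncomputable def energyForm {V : Type*} [Fintype V] (c : V → V → ℝ) :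
    (V → ℝ) →ₗ[ℝ] (V → ℝ) →ₗ[ℝ] ℝ :=
  LinearMap.mk₂ ℝ (fun u v => ∑ p, ∑ q, c p q * ((u p - u q) * (v p - v q)))
    (fun u u' v => by
      simp only [← sum_add_distrib, Pi.add_apply]
      exact sum_congr rfl fun p _ => sum_congr rfl fun q _ => by ring)
    (fun t u v => by
      simp only [smul_eq_mul, mul_sum, Pi.smul_apply]
      exact sum_congr rfl fun p _ => sum_congr rfl fun q _ => by ring)
    (fun u v v' => by
      simp only [← sum_add_distrib, Pi.add_apply]
      exact sum_congr rfl fun p _ => sum_congr rfl fun q _ => by ring)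
    (fun t u v => by
      simp only [smul_eq_mul, mul_sum, Pi.smul_apply]
      exact sum_congr rfl fun p _ => sum_congr rfl fun q _ => by ring)

theorem energyForm_apply {V : Type*} [Fintype V] (c : V → V → ℝ) (u v : V → ℝ) :
    energyForm c u v = ∑ p, ∑ q, c p q * ((u p - u q) * (v p - v q)) := rfl

theorem energyForm_comm {V : Type*} [Fintype V] (c : V → V → ℝ) (u v : V → ℝ) :
    energyForm c u v = energyForm c v u := by
  simp only [energyForm_apply, mul_comm (u _ - u _)]

theorem energyForm_self_nonneg {V : Type*} [Fintype V] {c : V → V → ℝ}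
    (hc : ∀ p q, 0 ≤ c p q) (u : V → ℝ) : 0 ≤ energyForm c u u :=
  sum_nonneg fun p _ => sum_nonneg fun q _ => mul_nonneg (hc p q) (mul_self_nonneg _)

theorem energyForm_const_right {V : Type*} [Fintype V] (c : V → V → ℝ) (u : V → ℝ) (t : ℝ) :
    energyForm c u (fun _ => t) = 0 := by
  simp [energyForm_apply]

/-- A functional vanishing on the kernel of a symmetric bilinear form is represented by it. -/
theorem exists_represents {W : Type*} [AddCommGroup W] [Module ℝ W] [FiniteDimensional ℝ W]
    (B : W →ₗ[ℝ] W →ₗ[ℝ] ℝ) (hB : ∀ u v, B u v = B v u) (l : W →ₗ[ℝ] ℝ)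
    (hl : ∀ u, B u = 0 → l u = 0) : ∃ u, ∀ v, B u v = l v := by
  have hmem : l ∈ (LinearMap.ker B).dualAnnihilator := by
    rw [Submodule.mem_dualAnnihilator]
    exact fun u hu => hl u hu
  rw [← LinearMap.range_dualMap_eq_dualAnnihilator_ker] at hmem
  obtain ⟨Φ, rfl⟩ := hmem
  obtain ⟨u, rfl⟩ := (Module.evalEquiv ℝ W).surjective Φ
  exact ⟨u, fun v => by simp [hB u v]⟩

/-- The maximum principle: the potential of a unit current from `p` to `o` is minimal at `o`. -/
theorem potential_min {V : Type*} [Fintype V] {c : V → V → ℝ} (hc : ∀ p q, 0 ≤ c p q)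
    (hirr : ∀ u, energyForm c u u = 0 → ∀ p q, u p = u q) {h : V → ℝ} {p o : V}
    (hh : ∀ v, energyForm c h v = v p - v o) (q : V) : h o ≤ h q := by
  set v : V → ℝ := fun x => min (h x - h o) 0 with hv
  have hle : energyForm c v v ≤ energyForm c h v := by
    refine sum_le_sum fun x _ => sum_le_sum fun y _ => mul_le_mul_of_nonneg_left ?_ (hc x y)
    simp only [hv]
    rcases min_cases (h x - h o) 0 with ⟨h1, h2⟩ | ⟨h1, h2⟩ <;>
      rcases min_cases (h y - h o) 0 with ⟨h3, h4⟩ | ⟨h3, h4⟩ <;> rw [h1, h3] <;> nlinarith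
  have hvo : v o = 0 := by simp [hv]
  have hvp : v p ≤ 0 := min_le_right _ _
  have h0 : energyForm c v v = 0 :=
    le_antisymm (by linarith [hh v]) (energyForm_self_nonneg hc v)
  have := hirr v h0 q o
  rw [hvo] at this
  have := min_eq_right_iff.mp this
  linarith

/-- The Gromov product `(p | q)_o` for the effective resistance, in terms of potentials `g`. -/
noncomputable def gromov {V : Type*} [Fintype V] (c : V → V → ℝ) (g : V → V → ℝ) (o p q : V) : ℝ :=
  energyForm c (g p - g o) (g q - g o)

/-- The effective resistance between two points, in terms of potentials `g`. -/
noncomputable def resistance {V : Type*} [Fintype V] (c : V → V → ℝ) (g : V → V → ℝ)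
    (p q : V) : ℝ :=
  energyForm c (g p - g q) (g p - g q)

theorem resistance_comm {V : Type*} [Fintype V] (c : V → V → ℝ) (g : V → V → ℝ) (p q : V) :
    resistance c g p q = resistance c g q p := by
  simp only [resistance, map_sub, LinearMap.sub_apply]; ring

theorem gromov_eq {V : Type*} [Fintype V] (c : V → V → ℝ) (g : V → V → ℝ) (o p q : V) :
    gromov c g o p q =
      (resistance c g o p + resistance c g o q - resistance c g p q) / 2 := by
  simp only [gromov, resistance, map_sub, LinearMap.sub_apply, energyForm_comm c (g q) (g p),
    energyForm_comm c (g o) (g p), energyForm_comm c (g o) (g q)]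
  ring

/-- Energy of the potential of a balanced current with three terminals (star-triangle). -/
theorem energyForm_three {V : Type*} [Fintype V] (c : V → V → ℝ) (g : V → V → ℝ) (p q o : V)
    {x y z : ℝ} (h : x + y = z) :
    energyForm c (x • g p + y • g q - z • g o) (x • g p + y • g q - z • g o) =
      gromov c g p q o * x ^ 2 + gromov c g q p o * y ^ 2 + gromov c g o p q * z ^ 2 := by
  subst h
  simp only [gromov, map_sub, map_add, map_smul, LinearMap.sub_apply, LinearMap.add_apply,
    LinearMap.smul_apply, smul_eq_mul, energyForm_comm c (g q) (g p),
    energyForm_comm c (g o) (g p), energyForm_comm c (g o) (g q)]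
  ring

theorem exists_potentials {V : Type*} [Fintype V] [Nonempty V] {c : V → V → ℝ}
    (hirr : ∀ u, energyForm c u u = 0 → ∀ p q, u p = u q) :
    ∃ g : V → V → ℝ, ∀ p q v, energyForm c (g p - g q) v = v p - v q := by
  obtain ⟨o⟩ := ‹Nonempty V›
  have (p : V) : ∃ u, ∀ v, energyForm c u v = v p - v o := by
    refine exists_represents (energyForm c) (energyForm_comm c)
      (LinearMap.proj (R := ℝ) (φ := fun _ : V => ℝ) p - LinearMap.proj o) fun u hu => ?_
    simp [hirr u (by simp [hu]) p o]
  choose g hg using this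
  exact ⟨g, fun p q v => by rw [map_sub, LinearMap.sub_apply, hg, hg]; ring⟩

theorem gromov_nonneg {V : Type*} [Fintype V] {c : V → V → ℝ} (hc : ∀ p q, 0 ≤ c p q)
    (hirr : ∀ u, energyForm c u u = 0 → ∀ p q, u p = u q) {g : V → V → ℝ}
    (hg : ∀ p q v, energyForm c (g p - g q) v = v p - v q) (o p q : V) :
    0 ≤ gromov c g o p q := by
  rw [gromov, energyForm_comm, hg, sub_nonneg]
  exact potential_min hc hirr (hg p o) q

theorem resistance_pos {V : Type*} [Fintype V] [DecidableEq V] {c : V → V → ℝ}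
    (hc : ∀ p q, 0 ≤ c p q)
    (hirr : ∀ u, energyForm c u u = 0 → ∀ p q, u p = u q) {g : V → V → ℝ}
    (hg : ∀ p q v, energyForm c (g p - g q) v = v p - v q) {p q : V} (hpq : p ≠ q) :
    0 < resistance c g p q := by
  refine lt_of_le_of_ne (energyForm_self_nonneg hc _) fun h => ?_
  have hconst := hirr _ h.symm
  have h1 := hg p q (Pi.single p 1)
  rw [show g p - g q = fun _ => (g p - g q) q from funext fun x => hconst x q,
    energyForm_comm, energyForm_const_right] at h1
  simp [hpq.symm] at h1

/-- The index of the point of `V⁰` sent by `ψ i` to the contact point with the previous cell. -/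
def prevTerminal (i : ZMod 20) : ZMod 20 := if i.val % 2 = 1 then i - 9 else i - 1

/-- The index of the point of `V⁰` sent by `ψ i` to the contact point with the next cell. -/
def nextTerminal (i : ZMod 20) : ZMod 20 := if i.val % 2 = 1 then i + 1 else i + 9

theorem prevTerminal_ne (i : ZMod 20) : prevTerminal i ≠ i := by
  revert i; decide

theorem nextTerminal_ne (i : ZMod 20) : nextTerminal i ≠ i := by
  revert i; decide

theorem prevTerminal_ne_nextTerminal (i : ZMod 20) : prevTerminal i ≠ nextTerminal i := by
  revert i; decide

theorem val_add_one_mod_two (i : ZMod 20) : (i + 1).val % 2 = 1 ↔ ¬ i.val % 2 = 1 := by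
  revert i; decide

namespace ExampleFractal

theorem glue (F : ExampleFractal V1) (i : ZMod 20) :
    F.ψ i (nextTerminal i) = F.ψ (i + 1) (prevTerminal (i + 1)) := by
  by_cases h : i.val % 2 = 1
  · have h' := val_add_one_mod_two i
    simp only [nextTerminal, prevTerminal, h, h', not_true, if_true, if_false]
    rw [(F.inter_odd i h).1, add_sub_cancel_right]
  · have h' := (val_add_one_mod_two i).2 h
    simp only [nextTerminal, prevTerminal, h, h', if_true, if_false]
    rw [(F.inter_even i (by lia)).1]
    congr 1; ring

theorem range_inter_range (F : ExampleFractal V1) (i : ZMod 20) :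
    Set.range (F.ψ i) ∩ Set.range (F.ψ (i + 1)) = {F.ψ i (nextTerminal i)} := by
  by_cases h : i.val % 2 = 1
  · simpa only [nextTerminal, h, if_true] using (F.inter_odd i h).2
  · simpa only [nextTerminal, h, if_false] using (F.inter_even i (by lia)).2

theorem eq_terminals_of_psi_eq (F : ExampleFractal V1) {i k l : ZMod 20}
    (h : F.ψ i k = F.ψ (i + 1) l) : k = nextTerminal i ∧ l = prevTerminal (i + 1) := by
  have hm : F.ψ i k ∈ Set.range (F.ψ i) ∩ Set.range (F.ψ (i + 1)) := ⟨⟨k, rfl⟩, ⟨l, h.symm⟩⟩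
  rw [F.range_inter_range, Set.mem_singleton_iff] at hm
  exact ⟨F.ψ_inj i hm, F.ψ_inj (i + 1) (by rw [← h, hm, F.glue])⟩

/-- The only identifications in `V¹` are those between contact points of consecutive cells. -/
theorem psi_eq_cases (F : ExampleFractal V1) {i i' k k' : ZMod 20} (h : F.ψ i' k' = F.ψ i k) :
    (i' = i ∧ k' = k) ∨ (i' = i + 1 ∧ k = nextTerminal i ∧ k' = prevTerminal i') ∨
      (i = i' + 1 ∧ k' = nextTerminal i' ∧ k = prevTerminal i) := by
  by_cases h0 : i' = i
  · subst h0
    exact Or.inl ⟨rfl, F.ψ_inj _ h⟩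
  by_cases h1 : i' = i + 1
  · subst h1
    exact Or.inr (Or.inl ⟨rfl, F.eq_terminals_of_psi_eq h.symm⟩)
  by_cases h2 : i' = i - 1
  · obtain rfl : i = i' + 1 := by rw [h2]; ring
    exact Or.inr (Or.inr ⟨rfl, F.eq_terminals_of_psi_eq h⟩)
  · have hm : F.ψ i k ∈ Set.range (F.ψ i) ∩ Set.range (F.ψ i') := ⟨⟨k, rfl⟩, ⟨k', h⟩⟩
    rw [F.disj i i' h2 h0 h1] at hm
    exact hm.elim

theorem P_ne_psi (F : ExampleFractal V1) {i j k : ZMod 20} (h : k ≠ i) : F.P j ≠ F.ψ i k := by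
  intro hj
  by_cases hij : i = j
  · subst hij
    rw [← F.fixed] at hj
    exact h (F.ψ_inj _ hj).symm
  · exact F.sep i j hij ⟨k, hj.symm⟩

/-- If charges `m i` on the cells add up, in `V¹`, to the charge `μ` on `V⁰`, then each cell
carries charge at its three terminals only, and the charges at contact points cancel. -/
theorem charges (F : ExampleFractal V1) {m : ZMod 20 → ZMod 20 → ℝ} {μ : ZMod 20 → ℝ}
    (hm : ∀ w : V1 → ℝ, ∑ i, ∑ k, m i k * w (F.ψ i k) = ∑ i, μ i * w (F.P i)) (i : ZMod 20) :
    m i i = μ i ∧ m (i + 1) (prevTerminal (i + 1)) = - m i (nextTerminal i) ∧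
      ∀ k, k ≠ i → k ≠ prevTerminal i → k ≠ nextTerminal i → m i k = 0 := by
  classical
  have key (y : V1) : ∑ x : ZMod 20 × ZMod 20, (if F.ψ x.1 x.2 = y then m x.1 x.2 else 0) =
      ∑ i, if F.P i = y then μ i else 0 := by
    have := hm fun z => if z = y then 1 else 0
    simpa only [mul_ite, mul_one, mul_zero, ← Fintype.sum_prod_type'] using this
  refine ⟨?_, ?_, fun k h1 h2 h3 => ?_⟩
  · have h := key (F.ψ i i)
    rw [sum_eq_single (i, i), sum_eq_single i] at h
    · simpa [F.fixed] using h
    · intro j _ hj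
      exact if_neg fun e => hj (F.P_inj (by rw [e, F.fixed]))
    · simp
    · rintro ⟨i', k'⟩ - hne
      refine if_neg fun e => ?_
      rcases F.psi_eq_cases e with ⟨h, h'⟩ | ⟨-, h, -⟩ | ⟨-, -, h⟩
      · exact hne (Prod.ext h h')
      · exact nextTerminal_ne i h.symm
      · exact prevTerminal_ne i h.symm
    · simp
  · have h := key (F.ψ i (nextTerminal i))
    rw [sum_eq_add (i, nextTerminal i) (i + 1, prevTerminal (i + 1)),
      sum_eq_zero fun j _ => if_neg (F.P_ne_psi (nextTerminal_ne i))] at h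
    · simp only [if_true, F.glue] at h
      linarith
    · intro e
      have : (1 : ZMod 20) = 0 := by simpa using congrArg Prod.fst e
      exact absurd this (by decide)
    · rintro ⟨i', k'⟩ - ⟨hne, hne'⟩
      refine if_neg fun e => ?_
      rcases F.psi_eq_cases e with ⟨h, h'⟩ | ⟨rfl, -, h⟩ | ⟨rfl, -, h⟩
      · exact hne (Prod.ext h h')
      · exact hne' (Prod.ext rfl h)
      · exact prevTerminal_ne_nextTerminal _ h.symm
    · simp
    · simp
  · have h := key (F.ψ i k)
    rw [sum_eq_single (i, k), sum_eq_zero fun j _ => if_neg (F.P_ne_psi h1)] at h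
    · simpa using h
    · rintro ⟨i', k'⟩ - hne
      refine if_neg fun e => ?_
      rcases F.psi_eq_cases e with ⟨h, h'⟩ | ⟨-, h, -⟩ | ⟨-, -, h⟩
      · exact hne (Prod.ext h h')
      · exact h3 h
      · exact h2 h
    · simp

theorem eq_of_cellwise_const (F : ExampleFractal V1) {v : V1 → ℝ}
    (h : ∀ i k l, v (F.ψ i k) = v (F.ψ i l)) (i : ZMod 20) : v (F.P i) = v (F.P 0) := by
  have step (i : ZMod 20) : v (F.P (i + 1)) = v (F.P i) := by
    rw [← F.fixed, ← F.fixed, h i i (nextTerminal i), F.glue, h (i + 1)]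
  have hn (n : ℕ) : v (F.P (n : ZMod 20)) = v (F.P 0) := by
    induction n with
    | zero => simp
    | succ n ih => rw [Nat.cast_succ, step, ih]
  simpa using hn i.val

end ExampleFractal

theorem energyForm_eq_sum_single {V : Type*} [Fintype V] [DecidableEq V] (c : V → V → ℝ)
    (u w : V → ℝ) : energyForm c u w = ∑ k, energyForm c u (Pi.single k 1) * w k := by
  conv_lhs => rw [pi_eq_sum_univ' w]
  rw [map_sum]
  refine sum_congr rfl fun k _ => ?_
  rw [map_smul, smul_eq_mul, mul_comm]

/-- The potential generated in cell `i` by a ring current `j` with outlet `μ i`. -/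
noncomputable def cellPotential (g : ZMod 20 → ZMod 20 → ℝ) (μ j : ZMod 20 → ℝ) (i : ZMod 20) :
    ZMod 20 → ℝ :=
  μ i • g i + j (i - 1) • g (prevTerminal i) - j i • g (nextTerminal i)

theorem energyForm_cellPotential {c g : ZMod 20 → ZMod 20 → ℝ}
    (hg : ∀ p q v, energyForm c (g p - g q) v = v p - v q) {μ j : ZMod 20 → ℝ}
    (hj : ∀ i, μ i + j (i - 1) = j i) (i : ZMod 20) (w : ZMod 20 → ℝ) :
    energyForm c (cellPotential g μ j i) w =
      μ i * w i + j (i - 1) * w (prevTerminal i) - j i * w (nextTerminal i) := by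
  have : cellPotential g μ j i = μ i • (g i - g (nextTerminal i)) +
      j (i - 1) • (g (prevTerminal i) - g (nextTerminal i)) := by
    rw [cellPotential, ← hj i]
    module
  rw [this, map_add, map_smul, map_smul, LinearMap.add_apply, LinearMap.smul_apply,
    LinearMap.smul_apply, hg, hg, ← hj i, smul_eq_mul, smul_eq_mul]
  ring

/-- Thomson's principle, upper bound: every flow bounds the energy of a potential. -/
theorem energy_le_of_flow (F : ExampleFractal V1) {c g : ZMod 20 → ZMod 20 → ℝ}
    (hc : ∀ p q, 0 ≤ c p q)
    (hg : ∀ p q v, energyForm c (g p - g q) v = v p - v q) {r : ZMod 20 → ℝ} (hr : ∀ i, 0 < r i)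
    {ρ : ℝ} (hρ : 0 < ρ)
    (hlam : ∀ u x, (∀ v : V1 → ℝ, (∀ j, v (F.P j) = u j) →
      x ≤ ∑ i, r i * energyForm c (fun k => v (F.ψ i k)) (fun k => v (F.ψ i k))) →
      x ≤ ρ * energyForm c u u)
    {h μ j : ZMod 20 → ℝ} (hh : ∀ v, energyForm c h v = ∑ i, μ i * v i)
    (hj : ∀ i, μ i + j (i - 1) = j i) :
    energyForm c h h ≤
      ∑ i, ρ / r i * energyForm c (cellPotential g μ j i) (cellPotential g μ j i) := by
  set D : ZMod 20 → ℝ := fun i => energyForm c (cellPotential g μ j i) (cellPotential g μ j i)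
    with hD
  have hx := hlam (ρ⁻¹ • h) (2 * ρ⁻¹ * energyForm c h h - ∑ i, D i / r i) fun v hv => by
    have hcell (i : ZMod 20) : 2 * (μ i * v (F.P i) +
        (j (i - 1) * v (F.ψ i (prevTerminal i)) - j i * v (F.ψ i (nextTerminal i)))) - D i / r i ≤
        r i * energyForm c (fun k => v (F.ψ i k)) (fun k => v (F.ψ i k)) := by
      have h0 := energyForm_self_nonneg hc
        (r i • (fun k => v (F.ψ i k)) - cellPotential g μ j i)
      have h1 := energyForm_cellPotential hg hj i fun k => v (F.ψ i k)
      simp only [map_sub, map_smul, LinearMap.sub_apply, LinearMap.smul_apply, smul_eq_mul,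
        energyForm_comm c (fun k => v (F.ψ i k)) (cellPotential g μ j i), h1] at h0
      rw [F.fixed] at h0
      have hri := hr i
      rw [sub_le_iff_le_add, ← sub_le_iff_le_add', le_div_iff₀ hri]
      simp only [hD]
      linarith
    have hshift : ∑ i, j (i - 1) * v (F.ψ i (prevTerminal i)) =
        ∑ i, j i * v (F.ψ i (nextTerminal i)) := by
      rw [← Equiv.sum_comp (Equiv.addRight (1 : ZMod 20))]
      exact sum_congr rfl fun i _ => by simp [F.glue]
    have hsum := sum_le_sum fun i (_ : i ∈ univ) => hcell i
    rw [sum_sub_distrib, ← mul_sum, sum_add_distrib, sum_sub_distrib, hshift, sub_self,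
      add_zero] at hsum
    refine le_trans (le_of_eq ?_) hsum
    have := hh (ρ⁻¹ • h)
    rw [map_smul, smul_eq_mul] at this
    simp only [hv, ← this]
    ring
  simp only [map_smul, LinearMap.smul_apply, smul_eq_mul] at hx
  have hs : ∑ i, ρ / r i * D i = ρ * ∑ i, D i / r i := by
    rw [mul_sum]; exact sum_congr rfl fun i _ => by ring
  rw [hs]
  have e : ρ * (ρ⁻¹ * (ρ⁻¹ * energyForm c h h)) = ρ⁻¹ * energyForm c h h := by
    field_simp
  rw [e] at hx
  have : ρ⁻¹ * energyForm c h h ≤ ∑ i, D i / r i := by linarith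
  rwa [inv_mul_le_iff₀ hρ] at this

/-- Thomson's principle, lower bound: the energy of a potential is attained by some flow. -/
theorem exists_flow_le_energy (F : ExampleFractal V1) {c g : ZMod 20 → ZMod 20 → ℝ}
    (hc : ∀ p q, 0 ≤ c p q) (hirr : ∀ u, energyForm c u u = 0 → ∀ p q, u p = u q)
    (hg : ∀ p q v, energyForm c (g p - g q) v = v p - v q) {r : ZMod 20 → ℝ} (hr : ∀ i, 0 < r i)
    {ρ : ℝ} (hρ : 0 < ρ)
    (hlam : ∀ v : V1 → ℝ, ρ * energyForm c (fun j => v (F.P j)) (fun j => v (F.P j)) ≤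
      ∑ i, r i * energyForm c (fun k => v (F.ψ i k)) (fun k => v (F.ψ i k)))
    {h μ : ZMod 20 → ℝ} (hh : ∀ v, energyForm c h v = ∑ i, μ i * v i) :
    ∃ j : ZMod 20 → ℝ, (∀ i, μ i + j (i - 1) = j i) ∧
      ∑ i, ρ / r i * energyForm c (cellPotential g μ j i) (cellPotential g μ j i) ≤
        energyForm c h h := by
  have hμ : ∑ i, μ i = 0 := by
    have := hh fun _ => 1
    rw [energyForm_const_right] at this
    simpa using this.symm
  let S : (V1 → ℝ) →ₗ[ℝ] (V1 → ℝ) →ₗ[ℝ] ℝ := ∑ i, r i • (energyForm c).compl₁₂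
    (LinearMap.funLeft ℝ ℝ (F.ψ i)) (LinearMap.funLeft ℝ ℝ (F.ψ i))
  have hS (v w : V1 → ℝ) : S v w =
      ∑ i, r i * energyForm c (fun k => v (F.ψ i k)) (fun k => w (F.ψ i k)) := by
    simp only [S, LinearMap.sum_apply]
    rfl
  let l : (V1 → ℝ) →ₗ[ℝ] ℝ := ∑ i, μ i • LinearMap.proj (F.P i)
  have hl (v : V1 → ℝ) : l v = ∑ i, μ i * v (F.P i) := by
    simp [l]
  obtain ⟨v, hv⟩ := exists_represents S
    (fun v w => by rw [hS, hS]; exact sum_congr rfl fun i _ => by rw [energyForm_comm])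
    l fun v hv => by
      have h0 : S v v = 0 := by rw [hv]; rfl
      rw [hS, sum_eq_zero_iff_of_nonneg fun i _ =>
        mul_nonneg (hr i).le (energyForm_self_nonneg hc _)] at h0
      have hconst := F.eq_of_cellwise_const fun i => hirr _
        ((mul_eq_zero.mp (h0 i (mem_univ i))).resolve_left (hr i).ne')
      rw [hl]
      simp only [hconst]
      rw [← sum_mul, hμ, zero_mul]
  set m : ZMod 20 → ZMod 20 → ℝ := fun i k =>
    r i * energyForm c (fun k => v (F.ψ i k)) (Pi.single k 1) with hmdef
  have hmw (i : ZMod 20) (w : ZMod 20 → ℝ) :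
      r i * energyForm c (fun k => v (F.ψ i k)) w = ∑ k, m i k * w k := by
    rw [energyForm_eq_sum_single, mul_sum]
    exact sum_congr rfl fun k _ => by rw [hmdef]; ring
  have hm := F.charges (m := m) (μ := μ) fun w => by
    simp only [← hl, ← hv, hS, hmw]
  set j : ZMod 20 → ℝ := fun i => - m i (nextTerminal i) with hjdef
  have hprev (i : ZMod 20) : m i (prevTerminal i) = j (i - 1) := by
    have := (hm (i - 1)).2.1
    rwa [sub_add_cancel] at this
  have hcur (i : ZMod 20) (w : ZMod 20 → ℝ) :
      r i * energyForm c (fun k => v (F.ψ i k)) w =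
        μ i * w i + j (i - 1) * w (prevTerminal i) - j i * w (nextTerminal i) := by
    rw [hmw, ← sum_subset (subset_univ {i, prevTerminal i, nextTerminal i}),
      sum_insert, sum_pair (prevTerminal_ne_nextTerminal i), hprev, (hm i).1, hjdef]
    · ring
    · simp [(prevTerminal_ne i).symm, (nextTerminal_ne i).symm]
    · intro k _ hk
      simp only [mem_insert, mem_singleton, not_or] at hk
      rw [(hm i).2.2 k hk.1 hk.2.1 hk.2.2, zero_mul]
  have hj (i : ZMod 20) : μ i + j (i - 1) = j i := by
    have := hcur i fun _ => 1
    rw [energyForm_const_right] at this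
    linarith
  refine ⟨j, hj, ?_⟩
  have hcell (i : ZMod 20) :
      energyForm c (cellPotential g μ j i) (cellPotential g μ j i) =
        r i * (r i * energyForm c (fun k => v (F.ψ i k)) (fun k => v (F.ψ i k))) := by
    rw [energyForm_cellPotential hg hj, ← hcur, energyForm_comm,
      energyForm_cellPotential hg hj, hcur]
  have hsum : ∑ i, ρ / r i * energyForm c (cellPotential g μ j i) (cellPotential g μ j i) =
      ρ * S v v := by
    rw [hS, mul_sum]
    refine sum_congr rfl fun i _ => ?_
    rw [hcell]
    have := (hr i).ne'
    field_simp
  rw [hsum]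
  have h1 := hlam v
  rw [← hS] at h1
  have h2 := energyForm_self_nonneg hc (ρ • (fun j => v (F.P j)) - h)
  simp only [map_sub, map_smul, LinearMap.sub_apply, LinearMap.smul_apply, smul_eq_mul,
    energyForm_comm c (fun j => v (F.P j)) h, hh (fun j => v (F.P j)), ← hl, ← hv] at h2
  nlinarith

theorem sum_ring_shift {b : ZMod 20 → ℝ} (p : ZMod 20) :
    ∑ i, b i = ∑ t ∈ range 20, b (p + t) := by
  rw [← Equiv.sum_comp (Equiv.addLeft p), ← Fin.sum_univ_eq_sum_range (fun t => b (p + t))]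
  refine sum_congr rfl fun i _ => congrArg b (congrArg (p + ·) ?_)
  exact (ZMod.natCast_zmod_val i).symm

theorem indicator_arc_sub (k : ℕ) (hk : k < 20) (i : ZMod 20) :
    (if i = 0 then (1 : ℤ) else 0) - (if i = k then 1 else 0) +
      (if (i - 1).val < k then 1 else 0) = if i.val < k then 1 else 0 := by
  revert i
  revert k
  decide

/-- The energy of a ring current which is `t + 1` on the arc of length `k` starting at `p`
and `t` elsewhere. -/
theorem sum_arc_current {b : ZMod 20 → ℝ} (p : ZMod 20) {k : ℕ} (hk : k < 20) (t : ℝ) :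
    ∑ i, b i * ((if (i - p).val < k then 1 else 0) + t) ^ 2 =
      (∑ n ∈ range k, b (p + n)) * (1 + 2 * t) + (∑ i, b i) * t ^ 2 := by
  have h1 : ∑ n ∈ range k, b (p + n) = ∑ i, b i * if (i - p).val < k then 1 else 0 := by
    rw [sum_ring_shift (b := fun i => b i * if (i - p).val < k then 1 else 0) p]
    simp only [mul_ite, mul_one, mul_zero, add_sub_cancel_left]
    rw [← sum_filter]
    refine (sum_congr ?_ fun _ _ => rfl).symm
    ext n
    simp only [mem_filter, mem_range]
    constructor
    · rintro ⟨hn, h⟩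
      rwa [ZMod.val_cast_of_lt hn] at h
    · intro h
      have hn := h.trans hk
      exact ⟨hn, by rwa [ZMod.val_cast_of_lt hn]⟩
  rw [h1, sum_mul, sum_mul, ← sum_add_distrib]
  refine sum_congr rfl fun i _ => ?_
  split_ifs <;> ring

theorem const_of_sub_one {d : ZMod 20 → ℝ} (h : ∀ i, d i = d (i - 1)) (i : ZMod 20) :
    d i = d 0 := by
  have hn (n : ℕ) : d (n : ZMod 20) = d 0 := by
    induction n with
    | zero => simp
    | succ n ih => rw [Nat.cast_succ, h, add_sub_cancel_right, ih]
  simpa using hn i.val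

/-- The effective resistance of a ring with resistances `b` and pendant resistances `a`. -/
theorem ring_resistance {a b : ZMod 20 → ℝ} (hb : ∀ i, 0 ≤ b i) {p : ZMod 20} {k : ℕ}
    (hk0 : 0 < k) (hk : k < 20) {R : ℝ} {μ : ZMod 20 → ℝ}
    (hμ : μ = Pi.single p 1 - Pi.single (p + k) 1)
    (hle : ∀ j : ZMod 20 → ℝ, (∀ i, μ i + j (i - 1) = j i) →
      R ≤ ∑ i, (a i * μ i ^ 2 + b i * j i ^ 2))
    (hge : ∃ j : ZMod 20 → ℝ, (∀ i, μ i + j (i - 1) = j i) ∧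
      ∑ i, (a i * μ i ^ 2 + b i * j i ^ 2) ≤ R) :
    R = a p + a (p + k) + (∑ n ∈ range k, b (p + n)) *
      (∑ i, b i - ∑ n ∈ range k, b (p + n)) / ∑ i, b i := by
  have hk' : (k : ZMod 20) ≠ 0 := fun e => by
    rw [ZMod.natCast_eq_zero_iff] at e
    exact absurd (Nat.le_of_dvd hk0 e) (by lia)
  have hpk : p ≠ p + k := by simpa using hk'
  have hμi (i : ZMod 20) : μ i = (if i = p then 1 else 0) - if i = p + k then 1 else 0 := by
    simp [hμ, Pi.single_apply]
  have hsumμ : ∑ i, a i * μ i ^ 2 = a p + a (p + k) := by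
    rw [sum_eq_add p (p + k) hpk]
    · simp [hμi, hpk, hpk.symm]
    · rintro i - ⟨h1, h2⟩
      simp [hμi, h1, h2]
    · simp
    · simp
  have harc (i : ZMod 20) :
      μ i + (if (i - 1 - p).val < k then 1 else 0) = if (i - p).val < k then 1 else 0 := by
    have h := indicator_arc_sub k hk (i - p)
    rw [sub_right_comm] at h
    simp only [sub_eq_zero] at h
    simp only [sub_eq_iff_eq_add'] at h
    rw [hμi]
    exact_mod_cast h
  have hflow (t : ℝ) : ∑ i, (a i * μ i ^ 2 + b i * ((if (i - p).val < k then 1 else 0) + t) ^ 2) =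
      a p + a (p + k) + ((∑ n ∈ range k, b (p + n)) * (1 + 2 * t) + (∑ i, b i) * t ^ 2) := by
    rw [sum_add_distrib, hsumμ, sum_arc_current p hk]
  set L := ∑ i, b i with hL
  set α := ∑ n ∈ range k, b (p + n) with hα
  have hα0 : 0 ≤ α := sum_nonneg fun _ _ => hb _
  have hαL : α ≤ L := by
    rw [hL, sum_ring_shift p]
    exact sum_le_sum_of_subset_of_nonneg (range_mono hk.le) fun _ _ _ => hb _
  apply le_antisymm
  · have := hle (fun i => (if (i - p).val < k then 1 else 0) + -(α / L)) fun i => by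
      rw [← harc i]; ring
    rw [hflow] at this
    refine this.trans (le_of_eq ?_)
    rcases (hα0.trans hαL).eq_or_lt with h0 | h0
    · have : α = 0 := le_antisymm (hαL.trans h0.ge) hα0
      simp [this]
    · field_simp
      ring
  · obtain ⟨j, hj, hjR⟩ := hge
    have hd := const_of_sub_one (d := fun i => j i - if (i - p).val < k then 1 else 0) fun i => by
      rw [← harc i, ← hj i]; ring
    set t := j 0 - if (0 - p).val < k then (1 : ℝ) else 0
    have hjt : j = fun i => (if (i - p).val < k then 1 else 0) + t :=
      funext fun i => by rw [← hd i]; ring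
    rw [hjt, hflow] at hjR
    refine le_trans ?_ hjR
    rcases (hα0.trans hαL).eq_or_lt with h0 | h0
    · have : α = 0 := le_antisymm (hαL.trans h0.ge) hα0
      simp [this, ← h0]
    · gcongr
      rw [div_le_iff₀ h0]
      nlinarith [sq_nonneg (L * t + α)]

theorem gromov_comm {V : Type*} [Fintype V] (c : V → V → ℝ) (g : V → V → ℝ) (o p q : V) :
    gromov c g o p q = gromov c g o q p :=
  energyForm_comm _ _ _

theorem gromov_of_ring {c g : ZMod 20 → ZMod 20 → ℝ} {a : ZMod 20 → ℝ} {p q o : ZMod 20}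
    {x y z L : ℝ} (hL : x + y + z = L)
    (hpq : resistance c g p q = a p + a q + x * (L - x) / L)
    (hqo : resistance c g q o = a q + a o + y * (L - y) / L)
    (hpo : resistance c g p o = a p + a o + (x + y) * (L - (x + y)) / L) :
    gromov c g q p o = a q + x * y / L ∧ gromov c g p q o = a p + x * z / L ∧
      gromov c g o p q = a o + y * z / L := by
  simp only [gromov_eq, resistance_comm c g q p, resistance_comm c g o p, resistance_comm c g o q,
    hpq, hqo, hpo]
  subst hL
  refine ⟨?_, ?_, ?_⟩ <;> ring

/-- In a pair of cells joined by a short edge, the two weights add up to at least one. -/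
theorem one_le_weight_add_weight {a a' x y y' w s s' L : ℝ} (ha : 0 ≤ a) (ha' : 0 ≤ a')
    (hx : 0 < x) (hy : 0 ≤ y) (hy' : 0 ≤ y') (hw : 0 ≤ w) (hs : 0 < s) (hs' : 0 < s')
    (hL : x + y' + w + y = L) (h1 : a = s * (a + x * y / L)) (h2 : a' = s' * (a' + x * y' / L))
    (h3 : x = s * (a' + x * (y' + w) / L) + s' * (a + x * (y + w) / L)) : 1 ≤ s + s' := by
  by_contra! h
  have hL0 : 0 < L := by linarith
  have e1 : s' * a ≤ s * (x * y / L) := by nlinarith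
  have e2 : s * a' ≤ s' * (x * y' / L) := by nlinarith
  have e3 : x ≤ x * ((s + s') * ((y + y' + w) / L)) := by
    calc x ≤ s' * (x * y' / L) + s * (x * (y' + w) / L) + (s * (x * y / L) +
          s' * (x * (y + w) / L)) := by linarith
      _ = _ := by ring
  have e4 : (y + y' + w) / L ≤ 1 := by rw [div_le_one hL0]; linarith
  have e5 : (s + s') * ((y + y' + w) / L) < 1 := by
    have : (s + s') * ((y + y' + w) / L) ≤ (s + s') * 1 := by gcongr
    linarith
  nlinarith

theorem pair_contribution {x y y' w s s' q L : ℝ} (hw : 0 ≤ w) (hs : 0 < s) (hs' : 0 < s')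
    (hss : 1 ≤ s + s') (hq : 0 ≤ q) (hy : q ≤ y) (hy' : q ≤ y') (hx : x ≤ q) (hqL : 2 * q ≤ L)
    (hL : x + y + w + y' = L) :
    q * L / 4 ≤ s * (y' * (y + w)) + s' * (y * (y' + w)) := by
  have aux {u v : ℝ} (hu : q ≤ u) (hv : q ≤ v) (h : u + v + w = L - x) :
      q * L / 4 ≤ u * (v + w) := by
    rcases le_total u v with huv | huv
    · nlinarith [mul_le_mul_of_nonneg_right hu (show 0 ≤ v + w by linarith)]
    · nlinarith [mul_le_mul_of_nonneg_right hv (show 0 ≤ u + w by linarith),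
        mul_nonneg hw (sub_nonneg.2 huv)]
  have h1 := aux hy' hy (by linarith)
  have h2 := aux hy hy' (by linarith)
  have h0 : 0 ≤ q * L / 4 := by
    have : 0 ≤ L := by linarith
    positivity
  nlinarith [mul_le_mul_of_nonneg_left h1 hs.le, mul_le_mul_of_nonneg_left h2 hs'.le]

/-- The length of the nine consecutive edges of the ring starting at `j`. -/
noncomputable def nineArc (b : ZMod 20 → ℝ) (j : ZMod 20) : ℝ := ∑ n ∈ range 9, b (j + n)

theorem nineArc_eq (b : ZMod 20 → ℝ) (j : ZMod 20) :
    nineArc b j = b j + b (j + 1) + b (j + 2) + b (j + 3) + b (j + 4) + b (j + 5) + b (j + 6) +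
      b (j + 7) + b (j + 8) := by
  simp [nineArc, sum_range_succ]

theorem nineArc_nonneg {b : ZMod 20 → ℝ} (hb : ∀ i, 0 ≤ b i) (j : ZMod 20) : 0 ≤ nineArc b j :=
  sum_nonneg fun _ _ => hb _

theorem ring_length (b : ZMod 20 → ℝ) (j : ZMod 20) :
    b (j - 1) + nineArc b j + b (j + 9) + nineArc b (j + 10) = ∑ i, b i := by
  have e : j - 1 = j + 19 := by revert j; decide
  rw [sum_ring_shift j, nineArc_eq, nineArc_eq, e]
  simp only [sum_range_succ, range_zero, sum_empty, add_assoc j]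
  norm_num
  ring

theorem no_ring_lengths {b s : ZMod 20 → ℝ} (hb : ∀ i, 0 ≤ b i)
    (hodd : ∀ i, i.val % 2 = 1 → 0 < b i) (hs : ∀ i, 0 < s i)
    (hss : ∀ j, j.val % 2 = 0 → 1 ≤ s (j - 1) + s j)
    (heven : ∀ j, j.val % 2 = 0 →
      s j * (nineArc b j * (nineArc b (j + 10) + b (j + 9))) +
        s (j + 1) * (nineArc b (j + 12) * (nineArc b (j + 2) + b (j + 11))) ≤
      (∑ i, b i) * b j) : False := by
  obtain ⟨j, hj, hmin⟩ := exists_min_image (univ.filter fun j : ZMod 20 => j.val % 2 = 0)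
    (nineArc b) ⟨0, by simp⟩
  simp only [mem_filter, mem_univ, true_and] at hj hmin
  have par : (j + 1).val % 2 = 1 ∧ (j + 2).val % 2 = 0 ∧ (j + 4).val % 2 = 0 ∧
      (j + 6).val % 2 = 0 ∧ (j + 8).val % 2 = 0 := by
    clear hmin
    revert j
    decide
  have par10 (i : ZMod 20) (hi : i.val % 2 = 0) : (i + 10).val % 2 = 0 := by
    revert i
    decide
  obtain ⟨p1, p2, p4, p6, p8⟩ := par
  set L := ∑ i, b i with hL
  have hq := nineArc_eq b j
  have hL0 : 2 * nineArc b j ≤ L := by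
    have := ring_length b j
    linarith [hmin _ (par10 j hj), hb (j - 1), hb (j + 9)]
  have bound (i : ZMod 20) (hi : i.val % 2 = 0) (hx : b (i - 1) ≤ nineArc b j) :
      nineArc b j * L / 4 ≤ s (i - 1) * (nineArc b (i + 10) * (nineArc b i + b (i + 9))) +
        s i * (nineArc b i * (nineArc b (i + 10) + b (i + 9))) :=
    pair_contribution (hb _) (hs _) (hs _) (hss i hi) (nineArc_nonneg hb _) (hmin i hi)
      (hmin _ (par10 i hi)) hx hL0 (ring_length b i)
  have hb' (n : ZMod 20) := hb (j + n)
  have b2 := bound (j + 2) p2 (by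
    rw [show j + 2 - 1 = j + 1 by ring]
    linarith [hb j, hb' 2, hb' 3, hb' 4, hb' 5, hb' 6, hb' 7, hb' 8])
  have b4 := bound (j + 4) p4 (by
    rw [show j + 4 - 1 = j + 3 by ring]
    linarith [hb j, hb' 1, hb' 2, hb' 4, hb' 5, hb' 6, hb' 7, hb' 8])
  have b6 := bound (j + 6) p6 (by
    rw [show j + 6 - 1 = j + 5 by ring]
    linarith [hb j, hb' 1, hb' 2, hb' 3, hb' 4, hb' 6, hb' 7, hb' 8])
  have b8 := bound (j + 8) p8 (by
    rw [show j + 8 - 1 = j + 7 by ring]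
    linarith [hb j, hb' 1, hb' 2, hb' 3, hb' 4, hb' 5, hb' 6, hb' 8])
  have e0 := heven j hj
  have e2 := heven (j + 2) p2
  have e4 := heven (j + 4) p4
  have e6 := heven (j + 6) p6
  have e8 := heven (j + 8) p8
  simp only [add_sub_assoc, add_assoc j] at b2 b4 b6 b8 e0 e2 e4 e6 e8
  norm_num at b2 b4 b6 b8 e0 e2 e4 e6 e8
  have hn (i k l n : ZMod 20) : 0 ≤ s i * (nineArc b k * (nineArc b l + b n)) :=
    mul_nonneg (hs i).le (mul_nonneg (nineArc_nonneg hb k)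
      (add_nonneg (nineArc_nonneg hb l) (hb n)))
  have hlt : b j + b (j + 2) + b (j + 4) + b (j + 6) + b (j + 8) < nineArc b j := by
    linarith [hodd (j + 1) p1, hb' 3, hb' 5, hb' 7]
  have hLpos : 0 < L := by
    have := hodd (j + 1) p1
    linarith [hb j, hb' 2, hb' 4, hb' 6, hb' 8]
  have hfin := mul_lt_mul_of_pos_left hlt hLpos
  linarith [hn j j (j + 10) (j + 9), hn (j + 9) (j + 20) (j + 10) (j + 19)]

theorem terminals_of_even (j : ZMod 20) (hj : j.val % 2 = 0) :
    prevTerminal j = j - 1 ∧ nextTerminal j = j + 9 ∧ prevTerminal (j - 1) = j + 10 ∧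
      nextTerminal (j - 1) = j := by
  revert j
  decide

/-- The nonexistence argument, once the effective resistances of the form are known to be those
of a ring with pendant edges. -/
theorem no_selfsimilar_ring {c g : ZMod 20 → ZMod 20 → ℝ} {a b s : ZMod 20 → ℝ}
    (hgromov : ∀ o p q, 0 ≤ gromov c g o p q) (hpos : ∀ p q, p ≠ q → 0 < resistance c g p q)
    (hs : ∀ i, 0 < s i)
    (ha : ∀ i, a i = s i * gromov c g i (prevTerminal i) (nextTerminal i))
    (hb : ∀ i, b i = s i * gromov c g (nextTerminal i) i (prevTerminal i) +
      s (i + 1) * gromov c g (prevTerminal (i + 1)) (i + 1) (nextTerminal (i + 1)))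
    (hR : ∀ (p : ZMod 20) (k : ℕ), 0 < k → k < 20 → resistance c g p (p + k) =
      a p + a (p + k) + (∑ n ∈ range k, b (p + n)) *
        (∑ i, b i - ∑ n ∈ range k, b (p + n)) / ∑ i, b i) : False := by
  have ha0 (i : ZMod 20) : 0 ≤ a i := by
    rw [ha]
    exact mul_nonneg (hs i).le (hgromov _ _ _)
  have hb0 (i : ZMod 20) : 0 ≤ b i := by
    rw [hb]
    exact add_nonneg (mul_nonneg (hs _).le (hgromov _ _ _)) (mul_nonneg (hs _).le (hgromov _ _ _))
  have hY := nineArc_nonneg hb0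
  set L := ∑ i, b i with hL
  have hlen := ring_length b
  rw [← hL] at hlen
  have R1 (j : ZMod 20) : resistance c g (j - 1) j =
      a (j - 1) + a j + b (j - 1) * (L - b (j - 1)) / L := by
    simpa using hR (j - 1) 1 (by lia) (by lia)
  have R9 (j : ZMod 20) : resistance c g j (j + 9) =
      a j + a (j + 9) + nineArc b j * (L - nineArc b j) / L :=
    hR j 9 (by lia) (by lia)
  have R10 (j : ZMod 20) : resistance c g j (j + 10) =
      a j + a (j + 10) + (nineArc b j + b (j + 9)) * (L - (nineArc b j + b (j + 9))) / L := by
    have := hR j 10 (by lia) (by lia)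
    rwa [sum_range_succ] at this
  have R10' (j : ZMod 20) : resistance c g (j - 1) (j + 9) = a (j - 1) + a (j + 9) +
      (b (j - 1) + nineArc b j) * (L - (b (j - 1) + nineArc b j)) / L := by
    have e : j - 1 + ((10 : ℕ) : ZMod 20) = j + 9 := by revert j; decide
    have es : ∑ n ∈ range 10, b (j - 1 + n) = b (j - 1) + nineArc b j := by
      rw [sum_range_succ', add_comm, nineArc]
      congr 1
      · simp
      · exact sum_congr rfl fun n _ => by congr 1; push_cast; ring
    have := hR (j - 1) 10 (by lia) (by lia)
    rwa [e, es] at this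
  have R11 (j : ZMod 20) : resistance c g (j - 1) (j + 10) = a (j - 1) + a (j + 10) +
      (b (j - 1) + (nineArc b j + b (j + 9))) *
        (L - (b (j - 1) + (nineArc b j + b (j + 9)))) / L := by
    have e : j - 1 + ((11 : ℕ) : ZMod 20) = j + 10 := by revert j; decide
    have es : ∑ n ∈ range 11, b (j - 1 + n) = b (j - 1) + (nineArc b j + b (j + 9)) := by
      rw [sum_range_succ', add_comm, sum_range_succ, nineArc]
      congr 1
      · simp
      · congr 1
        · exact sum_congr rfl fun n _ => by congr 1; push_cast; ring
        · congr 1; push_cast; ring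
    have := hR (j - 1) 11 (by lia) (by lia)
    rwa [e, es] at this
  have even_cell (j : ZMod 20) := gromov_of_ring (z := b (j + 9) + nineArc b (j + 10))
    (by linarith [hlen j]) (R1 j) (R9 j) (R10' j)
  have odd_cell (j : ZMod 20) := gromov_of_ring (z := nineArc b (j + 10))
    (by linarith [hlen j]) (R1 j) (R10 j) (R11 j)
  have a_even (j : ZMod 20) (hj : j.val % 2 = 0) :
      a j = s j * (a j + b (j - 1) * nineArc b j / L) := by
    obtain ⟨h1, h2, -, -⟩ := terminals_of_even j hj
    rw [← (even_cell j).1, ha, h1, h2]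
  have a_odd (j : ZMod 20) (hj : j.val % 2 = 0) :
      a (j - 1) = s (j - 1) * (a (j - 1) + b (j - 1) * nineArc b (j + 10) / L) := by
    obtain ⟨-, -, h1, h2⟩ := terminals_of_even j hj
    rw [← (odd_cell j).2.1, ha, h1, h2, gromov_comm]
  have b_odd (j : ZMod 20) (hj : j.val % 2 = 0) : b (j - 1) =
      s (j - 1) * (a j + b (j - 1) * (nineArc b j + b (j + 9)) / L) +
        s j * (a (j - 1) + b (j - 1) * (nineArc b (j + 10) + b (j + 9)) / L) := by
    obtain ⟨h1, h2, h3, h4⟩ := terminals_of_even j hj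
    rw [add_comm (nineArc b (j + 10)), ← (even_cell j).2.1, ← (odd_cell j).1, hb, sub_add_cancel,
      h1, h2, h3, h4]
  have b_even (j : ZMod 20) (hj : j.val % 2 = 0) : b j =
      s j * (a (j + 9) + nineArc b j * (b (j + 9) + nineArc b (j + 10)) / L) +
        s (j + 1) * (a (j + 12) + (nineArc b (j + 2) + b (j + 11)) * nineArc b (j + 12) / L) := by
    obtain ⟨h1, h2, -, -⟩ := terminals_of_even j hj
    obtain ⟨-, -, h3, h4⟩ := terminals_of_even (j + 2) (by revert j; decide)
    have h5 := (odd_cell (j + 2)).2.2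
    rw [show j + 2 - 1 = j + 1 by ring] at h3 h4 h5
    rw [show j + 2 + 10 = j + 12 by ring] at h3 h5
    rw [show j + 2 + 9 = j + 11 by ring] at h5
    rw [← (even_cell j).2.2, ← h5, hb, h1, h2, h3, h4, gromov_comm c g (j + 9)]
  have x_pos (j : ZMod 20) (hj : j.val % 2 = 0) : 0 < b (j - 1) := by
    refine (hb0 _).lt_of_ne fun h0 => ?_
    have h1 := b_odd j hj
    simp only [← h0, zero_mul, zero_div, add_zero] at h1
    have h2 : a j = 0 := by
      by_contra hne
      have : 0 < a j := (ha0 j).lt_of_ne' hne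
      nlinarith [mul_pos (hs (j - 1)) this, mul_nonneg (hs j).le (ha0 (j - 1))]
    have h3 : a (j - 1) = 0 := by
      by_contra hne
      have : 0 < a (j - 1) := (ha0 _).lt_of_ne' hne
      nlinarith [mul_pos (hs j) this, mul_nonneg (hs (j - 1)).le (ha0 j)]
    have h4 := hpos (j - 1) j fun e => absurd (sub_eq_self.1 e) (by decide)
    rw [R1, ← h0, h2, h3] at h4
    simp at h4
  have hLpos : 0 < L := by
    linarith [hlen 0, x_pos 0 (by simp), hY 0, hb0 (0 + 9), hY (0 + 10)]
  refine no_ring_lengths (s := s) hb0 (fun i hi => ?_) hs (fun j hj => ?_) fun j hj => ?_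
  · have := x_pos (i + 1) (by revert i; decide)
    rwa [add_sub_cancel_right] at this
  · exact one_le_weight_add_weight (ha0 _) (ha0 _) (x_pos j hj) (hY _) (hY _) (hb0 _) (hs _) (hs _)
      (hlen j) (a_odd j hj) (a_even j hj) (b_odd j hj)
  · have h := congrArg (L * ·) (b_even j hj)
    have e : L * (s j * (a (j + 9) + nineArc b j * (b (j + 9) + nineArc b (j + 10)) / L) +
        s (j + 1) * (a (j + 12) + (nineArc b (j + 2) + b (j + 11)) * nineArc b (j + 12) / L)) =
        s j * (L * a (j + 9) + nineArc b j * (b (j + 9) + nineArc b (j + 10))) +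
        s (j + 1) * (L * a (j + 12) +
          (nineArc b (j + 2) + b (j + 11)) * nineArc b (j + 12)) := by
      field_simp
    simp only [e] at h
    rw [← hL, h]
    have h1 := mul_nonneg (hs j).le (mul_nonneg hLpos.le (ha0 (j + 9)))
    have h2 := mul_nonneg (hs (j + 1)).le (mul_nonneg hLpos.le (ha0 (j + 12)))
    linarith

/-- Theorem 3.2: on the fractal triple `F̄` there exists no G-eigenform. -/
theorem no_G_eigenform (F : ExampleFractal V1) :
    ¬ ∃ (E : (ZMod 20 → ℝ) → ℝ) (r : ZMod 20 → ℝ) (ρ : ℝ),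
        IsIrreducibleDirichletForm E ∧ (∀ i, 0 < r i) ∧ 0 < ρ ∧
        Lam F r E = fun u => ρ * E u := by
  rintro ⟨E, r, ρ, ⟨⟨c, hc, -, hE⟩, hirrE⟩, hr, hρ, hLam⟩
  have hEc (u : ZMod 20 → ℝ) : E u = energyForm c u u := by
    rw [hE, energyForm_apply]
    exact sum_congr rfl fun p _ => sum_congr rfl fun q _ => by rw [pow_two]
  have hirr (u : ZMod 20 → ℝ) (hu : energyForm c u u = 0) : ∀ p q, u p = u q :=
    (hirrE u).1 (by rw [hEc, hu])
  obtain ⟨g, hg⟩ := exists_potentials hirr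
  have hS (v : V1 → ℝ) : S1r F r E v =
      ∑ i, r i * energyForm c (fun k => v (F.ψ i k)) (fun k => v (F.ψ i k)) := by
    simp only [S1r, hEc]
  have hinf (u : ZMod 20 → ℝ) :
      sInf {x : ℝ | ∃ v : V1 → ℝ, (∀ j, v (F.P j) = u j) ∧ S1r F r E v = x} =
        ρ * energyForm c u u := by
    rw [← hEc]
    exact congrFun hLam u
  have hupper (v : V1 → ℝ) : ρ * energyForm c (fun j => v (F.P j)) (fun j => v (F.P j)) ≤
      ∑ i, r i * energyForm c (fun k => v (F.ψ i k)) (fun k => v (F.ψ i k)) := by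
    rw [← hinf, ← hS]
    refine csInf_le ⟨0, ?_⟩ ⟨v, fun _ => rfl, rfl⟩
    rintro _ ⟨w, -, rfl⟩
    rw [hS]
    exact sum_nonneg fun i _ => mul_nonneg (hr i).le (energyForm_self_nonneg hc _)
  have hlower (u : ZMod 20 → ℝ) (x : ℝ) (hx : ∀ v : V1 → ℝ, (∀ j, v (F.P j) = u j) →
      x ≤ ∑ i, r i * energyForm c (fun k => v (F.ψ i k)) (fun k => v (F.ψ i k))) :
      x ≤ ρ * energyForm c u u := by
    rw [← hinf]
    refine le_csInf ⟨_, Function.extend F.P u 0, fun j => F.P_inj.extend_apply _ _ _, rfl⟩ ?_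
    rintro _ ⟨v, hv, rfl⟩
    rw [hS]
    exact hx v hv
  set s : ZMod 20 → ℝ := fun i => ρ / r i
  set a : ZMod 20 → ℝ := fun i => s i * gromov c g i (prevTerminal i) (nextTerminal i)
  set b : ZMod 20 → ℝ := fun i => s i * gromov c g (nextTerminal i) i (prevTerminal i) +
    s (i + 1) * gromov c g (prevTerminal (i + 1)) (i + 1) (nextTerminal (i + 1))
  have hs0 (i : ZMod 20) : 0 < s i := div_pos hρ (hr i)
  have hgr := gromov_nonneg hc hirr hg
  have hflow (μ j : ZMod 20 → ℝ) (hj : ∀ i, μ i + j (i - 1) = j i) :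
      ∑ i, s i * energyForm c (cellPotential g μ j i) (cellPotential g μ j i) =
        ∑ i, (a i * μ i ^ 2 + b i * j i ^ 2) := by
    have hshift : ∑ i, s i * gromov c g (prevTerminal i) i (nextTerminal i) * j (i - 1) ^ 2 =
        ∑ i, s (i + 1) * gromov c g (prevTerminal (i + 1)) (i + 1) (nextTerminal (i + 1)) *
          j i ^ 2 := by
      rw [← Equiv.sum_comp (Equiv.addRight (1 : ZMod 20))]
      exact sum_congr rfl fun i _ => by simp
    simp only [cellPotential, energyForm_three c g _ _ _ (hj _), a, b, add_mul, mul_add,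
      sum_add_distrib, ← mul_assoc]
    rw [hshift]
    ring
  have hb0 (i : ZMod 20) : 0 ≤ b i :=
    add_nonneg (mul_nonneg (hs0 _).le (hgr _ _ _)) (mul_nonneg (hs0 _).le (hgr _ _ _))
  refine no_selfsimilar_ring (a := a) (b := b) hgr (fun p q => resistance_pos hc hirr hg) hs0 (fun _ => rfl)
    (fun _ => rfl) fun p k hk0 hk => ?_
  have hh (v : ZMod 20 → ℝ) : energyForm c (g p - g (p + k)) v =
      ∑ i, (Pi.single p 1 - Pi.single (p + k) 1 : ZMod 20 → ℝ) i * v i := by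
    rw [hg]
    simp [sub_mul, Pi.single_apply]
  refine ring_resistance hb0 hk0 hk rfl (fun j hj => ?_) ?_
  · rw [← hflow _ _ hj]
    exact energy_le_of_flow F hc hg hr hρ hlower hh hj
  · obtain ⟨j, hj, hle⟩ := exists_flow_le_energy F hc hirr hg hr hρ hupper hh
    exact ⟨j, hj, by rw [← hflow _ _ hj]; exact hle⟩
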